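/- arXiv:2507.22476 — 4 statements merged into one kernel-verified Lean document; each statement's English description precedes it below -/
import Mathlib

section
/- No nonempty compact Hausdorff space can be covered by nowhere dense ccc P-sets: if X is a nonempty compact Hausdorff space, then X is not the union of a family of subsets each of which is a nowhere dense P-set whose subspace topology satisfies the countable chain condition (every pairwise disjoint family of nonempty relatively open subsets is countable). -/
open Set

/-- A subset `B` of a topological space is a P-set if the intersection of countably many
neighborhoods of `B` is again a neighborhood of `B`. -/
def IsPSet {X : Type*} [TopologicalSpace X] (B : Set X) : Prop :=
  ∀ U : ℕ → Set X, (∀ n, IsOpen (U n) ∧ B ⊆ U n) →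
    ∃ V : Set X, IsOpen V ∧ B ⊆ V ∧ V ⊆ ⋂ n, U n

/-- A topological space satisfies the countable chain condition if every pairwise disjoint
family of nonempty open sets is countable. -/
def CCCSpace (Y : Type*) [TopologicalSpace Y] : Prop :=
  ∀ 𝒰 : Set (Set Y), (∀ U ∈ 𝒰, IsOpen U ∧ U.Nonempty) → 𝒰.Pairwise Disjoint → 𝒰.Countable

/-- A P-set disjoint from countably many closed sets is disjoint from the closure of their
union. -/
theorem IsPSet.disjoint_closure_iUnion {X ι : Type*} [TopologicalSpace X] [Countable ι]
    {B : Set X} (hB : IsPSet B) {F : ι → Set X} (hF : ∀ i, IsClosed (F i))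
    (hd : ∀ i, Disjoint (F i) B) : Disjoint (closure (⋃ i, F i)) B := by
  cases isEmpty_or_nonempty ι
  · simp
  obtain ⟨e, he⟩ := exists_surjective_nat ι
  obtain ⟨V, hVo, hBV, hV⟩ := hB (fun n ↦ (F (e n))ᶜ)
    fun n ↦ ⟨(hF _).isOpen_compl, (hd _).subset_compl_left⟩
  refine Disjoint.mono_right hBV (Disjoint.closure_left ?_ hVo)
  rw [disjoint_iUnion_left]
  intro i
  obtain ⟨n, rfl⟩ := he i
  exact subset_compl_iff_disjoint_left.mp (hV.trans (iInter_subset _ n))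

theorem exists_isOpen_nonempty_closure_subset {X : Type*} [TopologicalSpace X] [RegularSpace X]
    {G : Set X} (hG : IsOpen G) (hne : G.Nonempty) :
    ∃ U, IsOpen U ∧ U.Nonempty ∧ closure U ⊆ G := by
  obtain ⟨x, hx⟩ := hne
  obtain ⟨V, hVo, hxV, hVG⟩ :=
    isCompact_singleton.exists_isOpen_closure_subset (by simpa using hG.mem_nhds hx)
  exact ⟨V, hVo, ⟨x, hxV rfl⟩, hVG⟩

/-- An open set meeting a nowhere dense P-set contains an uncountable disjoint family of nonempty
open sets. -/
theorem IsPSet.exists_uncountable_pairwise_disjoint {X : Type*} [TopologicalSpace X]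
    [RegularSpace X] {B G : Set X} (hB : IsPSet B) (hnd : IsNowhereDense B) (hG : IsOpen G)
    (hGB : (G ∩ B).Nonempty) :
    ∃ 𝒰 : Set (Set X), (∀ U ∈ 𝒰, IsOpen U ∧ U.Nonempty ∧ U ⊆ G) ∧ 𝒰.PairwiseDisjoint id ∧
      ¬ 𝒰.Countable := by
  obtain ⟨𝒰, h𝒰⟩ := zorn_subset
    {𝒰 : Set (Set X) | (∀ U ∈ 𝒰, IsOpen U ∧ U.Nonempty ∧ U ⊆ G ∧ Disjoint (closure U) B) ∧
      𝒰.PairwiseDisjoint id} fun c hc hchain ↦ by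
    refine ⟨⋃₀ c, ⟨?_, ?_⟩, fun s hs ↦ subset_sUnion_of_mem hs⟩
    · rintro U ⟨s, hs, hU⟩
      exact (hc hs).1 U hU
    · exact (pairwiseDisjoint_sUnion hchain.directedOn).2 fun s hs ↦ (hc hs).2
  refine ⟨𝒰, fun U hU ↦ ⟨(h𝒰.prop.1 U hU).1, (h𝒰.prop.1 U hU).2.1, (h𝒰.prop.1 U hU).2.2.1⟩,
    h𝒰.prop.2, fun hcount ↦ ?_⟩
  have : Countable 𝒰 := hcount
  have hdisj : Disjoint (closure (⋃ U : 𝒰, closure U.1)) B :=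
    hB.disjoint_closure_iUnion (fun _ ↦ isClosed_closure) fun U ↦ (h𝒰.prop.1 U U.2).2.2.2
  obtain ⟨x, hxG, hxB⟩ := hGB
  have hWo : IsOpen (G ∩ (closure (⋃ U : 𝒰, closure U.1))ᶜ) :=
    hG.inter isClosed_closure.isOpen_compl
  have hne : ((G ∩ (closure (⋃ U : 𝒰, closure U.1))ᶜ) ∩ (closure B)ᶜ).Nonempty := by
    by_contra hempty
    have hsub : G ∩ (closure (⋃ U : 𝒰, closure U.1))ᶜ ⊆ interior (closure B) :=
      interior_maximal (disjoint_compl_right_iff_subset.mp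
        (disjoint_iff_inter_eq_empty.mpr (not_nonempty_iff_eq_empty.mp hempty))) hWo
    rw [show interior (closure B) = ∅ from hnd] at hsub
    exact hsub ⟨hxG, fun h ↦ hdisj.le_bot ⟨h, hxB⟩⟩
  obtain ⟨V, hVo, hVne, hV⟩ :=
    exists_isOpen_nonempty_closure_subset (hWo.inter isClosed_closure.isOpen_compl) hne
  have hVU : ∀ U ∈ 𝒰, Disjoint V U := fun U hU ↦ disjoint_left.mpr fun y hyV hyU ↦
    (hV (subset_closure hyV)).1.2
      (subset_closure (mem_iUnion.mpr ⟨⟨U, hU⟩, subset_closure hyU⟩))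
  have hmem : V ∈ 𝒰 := by
    refine h𝒰.le_of_ge (y := insert V 𝒰) ⟨?_, ?_⟩ (subset_insert _ _) (mem_insert _ _)
    · rintro U (rfl | hU)
      · exact ⟨hVo, hVne, fun y hy ↦ (hV (subset_closure hy)).1.1,
          disjoint_left.mpr fun y hy hyB ↦ (hV hy).2 (subset_closure hyB)⟩
      · exact h𝒰.prop.1 U hU
    · exact h𝒰.prop.2.insert fun U hU _ ↦ hVU U hU
  exact hVne.ne_empty (disjoint_self.mp (hVU V hmem))

/-- A disjoint family of open sets has only countably many members meeting a given ccc subspace. -/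
theorem CCCSpace.countable_setOf_inter_nonempty {X ι : Type*} [TopologicalSpace X] {B : Set X}
    (hB : CCCSpace B) {O : ι → Set X} (hO : ∀ i, IsOpen (O i))
    (hd : Pairwise (Function.onFun Disjoint O)) : {i | (O i ∩ B).Nonempty}.Countable := by
  have hinj : InjOn (fun i ↦ ((↑) : B → X) ⁻¹' O i) {i | (O i ∩ B).Nonempty} := by
    rintro i ⟨x, hx, hxB⟩ j - hij
    by_contra hne
    exact (hd hne).le_bot ⟨hx, (Set.ext_iff.mp hij ⟨x, hxB⟩).mp hx⟩
  refine countable_of_injective_of_countable_image hinj (hB _ ?_ ?_)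
  · rintro _ ⟨i, ⟨x, hx, hxB⟩, rfl⟩
    exact ⟨(hO i).preimage continuous_subtype_val, ⟨x, hxB⟩, hx⟩
  · rintro _ ⟨i, -, rfl⟩ _ ⟨j, -, rfl⟩ hne
    exact (hd fun h ↦ hne (by rw [h])).preimage _

/-- A tree of nonempty open sets, indexed by finite lists, has nodes with prescribed finite sets of
entries lying below all of the corresponding level sets. -/
theorem exists_list_forall_mem_subset {X I : Type*} [LinearOrder I] {U : List I → Set X}
    (hU : ∀ a s, U (a :: s) ⊆ U s) (t : Finset I) :
    ∃ s : List I, (∀ b ∈ s, b ∈ t) ∧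
      ∀ a ∈ t, ∃ r : List I, (∀ b ∈ r, b ∈ Iio a) ∧ U s ⊆ U (a :: r) := by
  induction t using Finset.induction_on_max with
  | empty => exact ⟨[], by simp, by simp⟩
  | insert a t ha ih =>
    obtain ⟨s, hst, hs⟩ := ih
    refine ⟨a :: s, ?_, fun c hc ↦ ?_⟩
    · simp only [List.mem_cons, Finset.mem_insert]
      exact fun b hb ↦ hb.imp_right (hst b)
    · rcases Finset.mem_insert.mp hc with rfl | hc
      · exact ⟨s, fun b hb ↦ ha b (hst b hb), Subset.rfl⟩
      · obtain ⟨r, hr, hsr⟩ := hs c hc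
        exact ⟨r, hr, (hU a s).trans hsr⟩

/-- If every nonempty open set of a nonempty compact regular space contains an uncountable disjoint
family of nonempty open sets, then some point lies in no ccc P-set. -/
theorem exists_forall_notMem_of_isPSet_of_cccSpace {X : Type*} [TopologicalSpace X]
    [CompactSpace X] [RegularSpace X] [Nonempty X]
    (h : ∀ G : Set X, IsOpen G → G.Nonempty → ∃ 𝒰 : Set (Set X),
      (∀ U ∈ 𝒰, IsOpen U ∧ U.Nonempty ∧ U ⊆ G) ∧ 𝒰.PairwiseDisjoint id ∧ ¬ 𝒰.Countable) :
    ∃ x : X, ∀ B : Set X, IsPSet B → CCCSpace B → x ∉ B := by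
  let I : Type := (Cardinal.aleph 1).ord.ToType
  have hI : Cardinal.mk I = Cardinal.aleph 1 := Cardinal.mk_ord_toType _
  have hIio : ∀ a : I, (Iio a).Countable := fun a ↦ by
    rw [← Cardinal.le_aleph0_iff_set_countable, ← Cardinal.lt_aleph_one_iff]
    exact (Cardinal.mk_Iio_lt a (by rw [hI, Ordinal.type_toType])).trans_eq hI
  have hIunc : ¬ (univ : Set I).Countable := by
    rw [← Cardinal.le_aleph0_iff_set_countable, ← Cardinal.lt_aleph_one_iff, Cardinal.mk_univ, hI]
    exact lt_irrefl _
  have hsplit : ∀ G : {G : Set X // IsOpen G ∧ G.Nonempty},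
      ∃ V : I → {G : Set X // IsOpen G ∧ G.Nonempty}, (∀ i, (V i).1 ⊆ G.1) ∧
        ∀ B : Set X, CCCSpace B → {i | (closure (V i).1 ∩ B).Nonempty}.Countable := by
    rintro ⟨G, hGo, hGne⟩
    obtain ⟨𝒰, h𝒰, hd, hunc⟩ := h G hGo hGne
    have hcard : Cardinal.lift (Cardinal.mk I) ≤ Cardinal.lift (Cardinal.mk 𝒰) := by
      rw [← Cardinal.le_aleph0_iff_set_countable, ← Cardinal.lt_aleph_one_iff, not_lt] at hunc
      simpa [hI] using hunc
    obtain ⟨f⟩ := Cardinal.lift_mk_le'.mp hcard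
    choose V hVo hVne hV using fun i ↦
      exists_isOpen_nonempty_closure_subset (h𝒰 _ (f i).2).1 (h𝒰 _ (f i).2).2.1
    refine ⟨fun i ↦ ⟨V i, hVo i, hVne i⟩,
      fun i ↦ subset_closure.trans ((hV i).trans (h𝒰 _ (f i).2).2.2), fun B hB ↦ ?_⟩
    refine (hB.countable_setOf_inter_nonempty (O := fun i ↦ (f i).1)
      (fun i ↦ (h𝒰 _ (f i).2).1) fun i j hij ↦ hd (f i).2 (f j).2 fun heq ↦
        hij (f.injective (Subtype.ext heq))).mono fun i hi ↦ ?_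
    exact Nonempty.mono (inter_subset_inter_left _ (hV i)) hi
  choose V hVsub hVccc using hsplit
  let U : List I → {G : Set X // IsOpen G ∧ G.Nonempty} := fun s ↦
    s.rec ⟨univ, isOpen_univ, univ_nonempty⟩ fun a _ G ↦ V G a
  have hUsub : ∀ a s, (U (a :: s)).1 ⊆ (U s).1 := fun a s ↦ hVsub (U s) a
  let W : I → Set X := fun a ↦
    closure (⋃ s : {s : List I // ∀ b ∈ s, b ∈ Iio a}, closure (U (a :: s.1)).1)
  obtain ⟨x, hx⟩ : (⋂ a, W a).Nonempty := by
    refine CompactSpace.iInter_nonempty (fun _ ↦ isClosed_closure) fun t ↦ ?_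
    obtain ⟨s, -, hs⟩ := exists_list_forall_mem_subset (U := fun s ↦ (U s).1) hUsub t
    refine (U s).2.2.mono (subset_iInter₂ fun a ha ↦ ?_)
    obtain ⟨r, hr, hsr⟩ := hs a ha
    exact fun y hy ↦ subset_closure (mem_iUnion.mpr ⟨⟨r, hr⟩, subset_closure (hsr hy)⟩)
  refine ⟨x, fun B hP hccc hxB ↦ ?_⟩
  have hlevel : ∀ n : ℕ,
      {s : List I | s.length = n ∧ (closure (U s).1 ∩ B).Nonempty}.Countable := fun n ↦ by
    induction n with
    | zero => exact (countable_singleton []).mono fun s hs ↦ List.length_eq_zero_iff.mp hs.1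
    | succ n ih =>
      refine (ih.biUnion fun s _ ↦ (hVccc (U s) B hccc).image (· :: s)).mono ?_
      rintro (_ | ⟨a, s⟩) ⟨hlen, hne⟩
      · simp at hlen
      · exact mem_biUnion (show s ∈ {s : List I | _ ∧ _} from ⟨by simpa using hlen,
          hne.mono (inter_subset_inter_left _ (closure_mono (hUsub a s)))⟩) ⟨a, hne, rfl⟩
  have hcount : {a : I | ∃ s, (closure (U (a :: s)).1 ∩ B).Nonempty}.Countable := by
    refine ((countable_iUnion hlevel).biUnion fun s _ ↦ s.finite_toSet.countable).mono ?_
    rintro a ⟨s, hs⟩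
    exact mem_biUnion (mem_iUnion.mpr ⟨(a :: s).length, rfl, hs⟩)
      (show a ∈ {b | b ∈ a :: s} from List.mem_cons_self)
  obtain ⟨a, ha⟩ : ∃ a : I, ¬ ∃ s, (closure (U (a :: s)).1 ∩ B).Nonempty := by
    by_contra! hall
    exact hIunc (hcount.mono fun a _ ↦ hall a)
  have : Countable (Iio a) := hIio a
  have : Countable {s : List I // ∀ b ∈ s, b ∈ Iio a} := by
    have hr := countable_range (List.map ((↑) : Iio a → I))
    rw [range_list_map_coe] at hr
    exact hr
  refine (hP.disjoint_closure_iUnion (fun _ ↦ isClosed_closure) fun s ↦ ?_).le_bot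
    ⟨mem_iInter.mp hx a, hxB⟩
  exact disjoint_iff_inter_eq_empty.mpr (not_nonempty_iff_eq_empty.mp fun hne ↦ ha ⟨s.1, hne⟩)

/-- No nonempty compact Hausdorff space can be covered by nowhere dense ccc P-sets. -/
theorem no_cover_by_nwd_ccc_Psets (X : Type*) [TopologicalSpace X] [CompactSpace X]
    [T2Space X] [Nonempty X] :
    ¬ ∃ 𝒞 : Set (Set X),
        (∀ B ∈ 𝒞, IsNowhereDense B ∧ IsPSet B ∧ CCCSpace ↥B) ∧ ⋃₀ 𝒞 = univ := by
  rintro ⟨𝒞, h𝒞, hcover⟩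
  obtain ⟨x, hx⟩ := exists_forall_notMem_of_isPSet_of_cccSpace (X := X) fun G hGo ⟨y, hy⟩ ↦ by
    obtain ⟨B, hB, hyB⟩ : y ∈ ⋃₀ 𝒞 := hcover ▸ mem_univ y
    exact (h𝒞 B hB).2.1.exists_uncountable_pairwise_disjoint (h𝒞 B hB).1 hGo ⟨y, hy, hyB⟩
  obtain ⟨B, hB, hxB⟩ : x ∈ ⋃₀ 𝒞 := hcover ▸ mem_univ x
  exact hx B (h𝒞 B hB).2.1 (h𝒞 B hB).2.2 hxB
end

section
/- Assume CH. Then there exists a nonprincipal ultrafilter U on ℕ such that U ∩ I ≠ ∅ for every tall P-ideal I on ℕ. -/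
open Set

/-- `A ⊆* B`: `A` is almost contained in `B`, i.e. `A \ B` is finite. -/
def AlmostSubset (A B : Set ℕ) : Prop := (A \ B).Finite

/-- An ideal on ℕ: contains `∅`, does not contain `ℕ`, and is closed under subsets and
finite unions. -/
def IsIdealFam (I : Set (Set ℕ)) : Prop :=
  ∅ ∈ I ∧ (univ : Set ℕ) ∉ I ∧ (∀ A B : Set ℕ, B ∈ I → A ⊆ B → A ∈ I) ∧
    ∀ A B : Set ℕ, A ∈ I → B ∈ I → A ∪ B ∈ I

/-- A P-ideal: an ideal in which every countable subfamily has a pseudounion belonging to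
the ideal. -/
def IsPIdeal (I : Set (Set ℕ)) : Prop :=
  IsIdealFam I ∧ ∀ C : Set (Set ℕ), C.Countable → C ⊆ I →
    ∃ B ∈ I, ∀ A ∈ C, AlmostSubset A B

/-- A family of sets is tall if every infinite subset of ℕ has infinite intersection with
some member of the family. -/
def IsTallFam (I : Set (Set ℕ)) : Prop :=
  ∀ A : Set ℕ, A.Infinite → ∃ B ∈ I, (A ∩ B).Infinite

/-- A filter on ℕ: contains `ℕ`, does not contain `∅`, and is closed under finite
intersections and supersets. -/
def IsFilterFam (F : Set (Set ℕ)) : Prop :=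
  (univ : Set ℕ) ∈ F ∧ ∅ ∉ F ∧ (∀ A B : Set ℕ, A ∈ F → B ∈ F → A ∩ B ∈ F) ∧
    ∀ A B : Set ℕ, A ∈ F → A ⊆ B → B ∈ F

/-- A P-filter: a filter in which every countable subfamily has an infinite
pseudointersection belonging to the filter. -/
def IsPFilterFam (F : Set (Set ℕ)) : Prop :=
  IsFilterFam F ∧ ∀ C : Set (Set ℕ), C.Countable → C ⊆ F →
    ∃ X ∈ F, X.Infinite ∧ ∀ A ∈ C, AlmostSubset X A

/-- A family of sets is nowhere dense (as a filter) if it has no infinite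
pseudointersection. -/
def IsNwdFam (F : Set (Set ℕ)) : Prop :=
  ¬ ∃ X : Set ℕ, X.Infinite ∧ ∀ A ∈ F, AlmostSubset X A

/-- A (decreasing) tower: a `⊆*`-decreasing family of infinite subsets of ℕ indexed by an
ordinal `κ`, with no infinite pseudointersection. -/
def IsTower (κ : Ordinal) (A : Ordinal → Set ℕ) : Prop :=
  (∀ α < κ, (A α).Infinite) ∧
  (∀ α β : Ordinal, α < β → β < κ → AlmostSubset (A β) (A α)) ∧
  ¬ ∃ X : Set ℕ, X.Infinite ∧ ∀ α < κ, AlmostSubset X (A α)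

/-- An increasing tower: a `⊆*`-increasing family of infinite subsets of ℕ indexed by an
ordinal `κ` such that every infinite subset of ℕ has infinite intersection with some
member. -/
def IsIncTower (κ : Ordinal) (B : Ordinal → Set ℕ) : Prop :=
  (∀ α < κ, (B α).Infinite) ∧
  (∀ α β : Ordinal, α < β → β < κ → AlmostSubset (B α) (B β)) ∧
  ∀ X : Set ℕ, X.Infinite → ∃ γ < κ, (B γ ∩ X).Infinite

/-- An ultrafilter is nonprincipal if it contains no finite set. -/
def Nonprincipal (U : Ultrafilter ℕ) : Prop := ∀ A : Set ℕ, A.Finite → A ∉ U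

/-- In an uncountable well order with countable initial segments, every function has
closure points above any given element. -/
theorem exists_gt_forall_lt_map_lt {α : Type*} [LinearOrder α] [WellFoundedLT α] [Uncountable α]
    (hc : ∀ x : α, (Iic x).Countable) (g : α → α) (a : α) :
    ∃ d, a < d ∧ ∀ x < d, g x < d := by
  let step : Set α → Set α := fun S => ⋃ x ∈ S, Iic x ∪ Iic (g x)
  let J : ℕ → Set α := fun n => step^[n] (Iic a)
  have hsucc : ∀ n, J (n + 1) = step (J n) := fun n => Function.iterate_succ_apply' _ _ _
  have hJc : ∀ n, (J n).Countable := by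
    intro n
    induction n with
    | zero => exact hc a
    | succ n ih =>
      rw [hsucc]
      exact ih.biUnion fun x _ => (hc x).union (hc (g x))
  have hlow : ∀ x ∈ ⋃ n, J n, ∀ y, y ≤ x ∨ y ≤ g x → y ∈ ⋃ n, J n := by
    intro x hx y hy
    obtain ⟨n, hn⟩ := mem_iUnion.1 hx
    refine mem_iUnion.2 ⟨n + 1, ?_⟩
    rw [hsucc]
    exact mem_iUnion₂.2 ⟨x, hn, hy⟩
  have hne : (⋃ n, J n)ᶜ.Nonempty := by
    rw [nonempty_compl]
    intro h
    exact not_countable_univ (h ▸ countable_iUnion hJc)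
  obtain ⟨d, hd, hmin⟩ := WellFounded.has_min (wellFounded_lt (α := α)) _ hne
  have hlt : ∀ x ∈ ⋃ n, J n, x < d := fun x hx =>
    lt_of_not_ge fun h => hd (hlow x hx d (Or.inl h))
  refine ⟨d, hlt a (mem_iUnion.2 ⟨0, le_rfl⟩), fun x hx => hlt _ ?_⟩
  have hxJ : x ∈ ⋃ n, J n := by
    by_contra h
    exact hmin x h hx
  exact hlow x hxJ _ (Or.inr le_rfl)

theorem AlmostSubset.mono_left {A B C : Set ℕ} (hAB : A ⊆ B) (hBC : AlmostSubset B C) :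
    AlmostSubset A C :=
  hBC.subset (sdiff_subset_sdiff_left hAB)

/-- Given an enumeration `e` of the sets of naturals, each tall P-ideal has a member `A` and a
bound `d` such that every infinite set enumerated before `d` has an infinite subset, also
enumerated before `d`, which is almost contained in `A`. -/
theorem exists_mem_forall_infinite_exists_almostSubset {α : Type*} [LinearOrder α]
    [WellFoundedLT α] [Uncountable α] (hc : ∀ x : α, (Iic x).Countable) (e : Set ℕ ≃ α)
    {I : Set (Set ℕ)} (hP : IsPIdeal I) (hT : IsTallFam I) :
    ∃ A ∈ I, ∃ d, e univ < d ∧ ∀ X : Set ℕ, X.Infinite → e X < d →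
      ∃ Y ⊆ X, Y.Infinite ∧ e Y < d ∧ AlmostSubset Y A := by
  have hsub : ∀ X : Set ℕ, ∃ Y : Set ℕ, X.Infinite → Y ⊆ X ∧ Y.Infinite ∧ Y ∈ I := by
    intro X
    by_cases hX : X.Infinite
    · obtain ⟨B, hB, hXB⟩ := hT X hX
      exact ⟨X ∩ B, fun _ => ⟨inter_subset_left, hXB, hP.1.2.2.1 _ B hB inter_subset_right⟩⟩
    · exact ⟨X, fun h => absurd h hX⟩
  choose f hf using hsub
  obtain ⟨d, hd, hclosed⟩ := exists_gt_forall_lt_map_lt hc (fun x => e (f (e.symm x))) (e univ)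
  have hcount : (I ∩ e ⁻¹' Iio d).Countable :=
    (((hc d).mono Iio_subset_Iic_self).preimage e.injective).mono inter_subset_right
  obtain ⟨A, hA, hpseudo⟩ := hP.2 _ hcount inter_subset_left
  refine ⟨A, hA, d, hd, fun X hX hXd => ?_⟩
  obtain ⟨hYX, hY, hYI⟩ := hf X hX
  have hYd : e (f X) < d := by simpa using hclosed (e X) hXd
  exact ⟨f X, hYX, hY, hYd, hpseudo _ ⟨hYI, hYd⟩⟩

/-- If each `A i` almost contains an infinite subset enumerated before `d i` of every infinite set
enumerated before `d i`, then finite subfamilies of `A` have infinite pseudointersections. -/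
theorem exists_infinite_forall_almostSubset_of_finset {α ι : Type*} [LinearOrder α]
    (e : Set ℕ → α) (A : ι → Set ℕ) (d : ι → α) (hd : ∀ i, e univ < d i)
    (h : ∀ i, ∀ X : Set ℕ, X.Infinite → e X < d i →
      ∃ Y ⊆ X, Y.Infinite ∧ e Y < d i ∧ AlmostSubset Y (A i)) (t : Finset ι) :
    ∃ X : Set ℕ, X.Infinite ∧ ∀ i ∈ t, AlmostSubset X (A i) := by
  classical
  suffices H : ∃ X : Set ℕ, X.Infinite ∧ (∀ b, e univ < b → (∀ i ∈ t, d i ≤ b) → e X < b) ∧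
      ∀ i ∈ t, AlmostSubset X (A i) by
    obtain ⟨X, hX, -, hXA⟩ := H
    exact ⟨X, hX, hXA⟩
  induction t using Finset.induction_on_max_value d with
  | empty => exact ⟨univ, infinite_univ, fun b hb _ => hb, by simp⟩
  | insert i s _ hmax ih =>
    obtain ⟨X, hX, hXb, hXA⟩ := ih
    obtain ⟨Y, hYX, hY, hYd, hYA⟩ := h i X hX (hXb _ (hd i) hmax)
    refine ⟨Y, hY, fun b _ hb => hYd.trans_le (hb i (Finset.mem_insert_self i s)), ?_⟩
    intro j hj
    rcases Finset.mem_insert.1 hj with rfl | hj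
    · exact hYA
    · exact (hXA j hj).mono_left hYX

/-- A family of sets all of whose finite subfamilies have infinite pseudointersections is
contained in a nonprincipal ultrafilter. -/
theorem exists_nonprincipal_forall_mem {ι : Type*} (A : ι → Set ℕ)
    (h : ∀ t : Finset ι, ∃ X : Set ℕ, X.Infinite ∧ ∀ i ∈ t, AlmostSubset X (A i)) :
    ∃ U : Ultrafilter ℕ, Nonprincipal U ∧ ∀ i, A i ∈ U := by
  have hne : (Filter.cofinite ⊓ ⨅ i, Filter.principal (A i)).NeBot := by
    rw [Filter.inf_neBot_iff]
    intro s hs s' hs'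
    obtain ⟨t, ht, hts⟩ := (Filter.hasBasis_iInf_principal_finite A).mem_iff.1 hs'
    obtain ⟨X, hX, hXA⟩ := h ht.toFinset
    have hfin : (sᶜ ∪ ⋃ i ∈ t, X \ A i).Finite :=
      (Filter.mem_cofinite.1 hs).union
        (ht.biUnion fun i hi => hXA i (ht.mem_toFinset.2 hi))
    obtain ⟨x, hxX, hx⟩ := (hX.sdiff hfin).nonempty
    rw [mem_union, not_or, notMem_compl_iff] at hx
    refine ⟨x, hx.1, hts (mem_iInter₂.2 fun i hi => ?_)⟩
    by_contra hxi
    exact hx.2 (mem_iUnion₂.2 ⟨i, hi, hxX, hxi⟩)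
  have hle := Ultrafilter.of_le (Filter.cofinite ⊓ ⨅ i, Filter.principal (A i))
  refine ⟨Ultrafilter.of (Filter.cofinite ⊓ ⨅ i, Filter.principal (A i)), fun B hB hBU => ?_, fun i => ?_⟩
  · exact Ultrafilter.compl_notMem_iff.2 hBU (hle (Filter.mem_inf_of_left hB.compl_mem_cofinite))
  · exact hle (Filter.mem_inf_of_right
      (Filter.mem_iInf_of_mem i (Filter.mem_principal_self (A i))))

/-- Under CH, there is a nonprincipal ultrafilter on ℕ meeting every tall P-ideal. -/
theorem exists_ultrafilter_meeting_tall_Pideals_of_CH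
    (ch : (2 : Cardinal) ^ Cardinal.aleph0 = Cardinal.aleph 1) :
    ∃ U : Ultrafilter ℕ, Nonprincipal U ∧
      ∀ I : Set (Set ℕ), IsPIdeal I → IsTallFam I →
        ({A : Set ℕ | A ∈ U} ∩ I).Nonempty := by
  have ch₀ : (2 : Cardinal.{0}) ^ Cardinal.aleph0 = Cardinal.aleph 1 :=
    Cardinal.lift_injective (by simpa using ch)
  have hcard : Cardinal.mk (Set ℕ) = Cardinal.mk (Cardinal.aleph.{0} 1).ord.ToType := by
    rw [Cardinal.mk_set, Cardinal.mk_nat, ch₀, Cardinal.mk_ord_toType]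
  obtain ⟨e⟩ := Cardinal.eq.1 hcard
  have hc : ∀ x : (Cardinal.aleph.{0} 1).ord.ToType, (Iic x).Countable := by
    intro x
    rw [← Iio_insert]
    have hlt := Cardinal.mk_Iio_lt x (by simp)
    rw [Cardinal.mk_ord_toType, Cardinal.lt_aleph_one_iff,
      Cardinal.le_aleph0_iff_set_countable] at hlt
    exact hlt.insert x
  have : Uncountable (Cardinal.aleph.{0} 1).ord.ToType := by
    rw [← Cardinal.aleph0_lt_mk_iff, Cardinal.mk_ord_toType]
    exact Cardinal.aleph0_lt_aleph_one
  choose A hA d hd h using fun i : {I : Set (Set ℕ) // IsPIdeal I ∧ IsTallFam I} =>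
    exists_mem_forall_infinite_exists_almostSubset hc e i.2.1 i.2.2
  obtain ⟨U, hU, hAU⟩ := exists_nonprincipal_forall_mem A
    (exists_infinite_forall_almostSubset_of_finset e A d hd h)
  exact ⟨U, hU, fun I hP hT => ⟨A ⟨I, hP, hT⟩, hAU _, hA ⟨I, hP, hT⟩⟩⟩
end

section
/- Assume CH. Then ω* cannot be covered by nowhere dense P-sets: ω* is not the union of any family of subsets each of which is a nowhere dense P-set of ω*. -/
open Set

/-- `ω* = βℕ ∖ ℕ`: the space of nonprincipal ultrafilters on ℕ with the Stone topology
(as a subspace of the space of all ultrafilters on ℕ). -/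
def OmegaStar : Type := {U : Ultrafilter ℕ // Nonprincipal U}

instance : TopologicalSpace OmegaStar := instTopologicalSpaceSubtype

/-- A type of cardinality at most `ℵ₁` carries a linear order with countable initial segments. -/
theorem exists_linearOrder_countable_Iic {S : Type*} (hS : Cardinal.mk S ≤ Cardinal.aleph 1) :
    ∃ _ : LinearOrder S, ∀ s : S, (Set.Iic s).Countable := by
  obtain ⟨L, _, hL⟩ := Cardinal.exists_ord_eq_type_lt S
  refine ⟨L, fun s => ?_⟩
  rw [← Set.Iio_insert]
  refine (Cardinal.le_aleph0_iff_set_countable.1 (Order.lt_succ_iff.1 ?_)).insert s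
  rw [Cardinal.succ_aleph0]
  exact (Cardinal.mk_Iio_lt s hL).trans_le hS

/-- If every initial segment is countable, each point lies in a countable lower set that is closed
under a given function. -/
theorem exists_countable_lowerSet_mapsTo {S : Type*} [LinearOrder S]
    (hI : ∀ s : S, (Set.Iic s).Countable) (g : S → S) (s₀ : S) :
    ∃ D : LowerSet S, (D : Set S).Countable ∧ s₀ ∈ D ∧ ∀ s ∈ D, g s ∈ D := by
  let D : ℕ → Set S := fun n =>
    Nat.rec (Set.Iic s₀) (fun _ E => ⋃ s ∈ E, Set.Iic (g s)) n
  have hD : ∀ n, D (n + 1) = ⋃ s ∈ D n, Set.Iic (g s) := fun n => rfl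
  have hc : ∀ n, (D n).Countable := by
    intro n
    induction n with
    | zero => exact hI s₀
    | succ n ih => rw [hD]; exact ih.biUnion fun s _ => hI _
  have hl : ∀ n, IsLowerSet (D n) := by
    intro n
    cases n with
    | zero => exact isLowerSet_Iic s₀
    | succ n =>
      rw [hD]
      exact isLowerSet_iUnion₂ fun s _ => isLowerSet_Iic _
  refine ⟨⟨⋃ n, D n, isLowerSet_iUnion hl⟩, Set.countable_iUnion hc,
    Set.mem_iUnion.2 ⟨0, le_refl s₀⟩, fun s hs => ?_⟩
  obtain ⟨n, hn⟩ := Set.mem_iUnion.1 hs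
  exact Set.mem_iUnion.2 ⟨n + 1, by rw [hD]; exact Set.mem_biUnion hn (le_refl (g s))⟩

/-- A nonempty compact space with a π-base of at most `ℵ₁` clopen sets is not covered by nowhere
dense P-sets. -/
theorem not_sUnion_eq_univ_of_nowhereDense_isPSet {X : Type*} [TopologicalSpace X] [CompactSpace X]
    [Nonempty X] {S : Type*} (hS : Cardinal.mk S ≤ Cardinal.aleph 1) (c : S → Set X)
    (hclosed : ∀ s, IsClosed (c s)) (hopen : ∀ s, IsOpen (c s)) (hne : ∀ s, (c s).Nonempty)
    (hbase : ∀ U : Set X, IsOpen U → U.Nonempty → ∃ s, c s ⊆ U)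
    (C : Set (Set X)) (hC : ∀ B ∈ C, IsNowhereDense B ∧ IsPSet B) : ⋃₀ C ≠ Set.univ := by
  classical
  intro hcov
  obtain ⟨s₀, -⟩ := hbase Set.univ isOpen_univ Set.univ_nonempty
  obtain ⟨_, hI⟩ := exists_linearOrder_countable_Iic hS
  have shrink : ∀ B : C, ∀ s, ∃ t, c t ⊆ c s ∧ Disjoint (c t) B := by
    intro B s
    have hdense : Dense (closure (B : Set X))ᶜ := interior_eq_empty_iff_dense_compl.1 (hC B B.2).1
    obtain ⟨t, ht⟩ := hbase (c s ∩ (closure (B : Set X))ᶜ)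
      ((hopen s).inter isClosed_closure.isOpen_compl)
      (hdense.inter_open_nonempty _ (hopen s) (hne s))
    exact ⟨t, fun x hx => (ht hx).1,
      Set.disjoint_left.2 fun x hx hB => (ht hx).2 (subset_closure hB)⟩
  choose g hgs hgB using shrink
  choose D hDc hs₀ hDg using fun B : C => exists_countable_lowerSet_mapsTo hI (g B) s₀
  have nbhd : ∀ B : C, ∃ V : Set X, IsOpen V ∧ (B : Set X) ⊆ V ∧
      ∀ s ∈ D B, Disjoint (c s) B → Disjoint (c s) V := by
    intro B
    obtain ⟨e, he⟩ := (hDc B).exists_eq_range ⟨s₀, hs₀ B⟩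
    obtain ⟨V, hV, hBV, hVU⟩ := (hC B B.2).2
      (fun n => if Disjoint (c (e n)) B then (c (e n))ᶜ else Set.univ) (fun n => by
        split_ifs with h
        · exact ⟨(hclosed _).isOpen_compl, h.symm.subset_compl_right⟩
        · exact ⟨isOpen_univ, Set.subset_univ _⟩)
    refine ⟨V, hV, hBV, fun s hs hd => Set.disjoint_right.2 fun x hx => ?_⟩
    obtain ⟨n, rfl⟩ : s ∈ Set.range e := he ▸ hs
    simpa [hd] using Set.mem_iInter.1 (hVU hx) n
  choose V hVo hBV hVD using nbhd
  have finite : ∀ t : Finset C, ∃ s, (∀ B ∈ t, Disjoint (c s) (V B)) ∧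
      ∀ E : LowerSet S, s₀ ∈ E → (∀ B ∈ t, D B ≤ E) → s ∈ E := by
    intro t
    induction t using Finset.induction_on_max_value D with
    | empty => exact ⟨s₀, by simp, fun E hE _ => hE⟩
    | insert B t _ hmax ih =>
      obtain ⟨s, hs, hsE⟩ := ih
      have hg : g B s ∈ D B := hDg B s (hsE (D B) (hs₀ B) hmax)
      refine ⟨g B s, fun B' hB' => ?_, fun E _ hE => hE B (Finset.mem_insert_self B t) hg⟩
      rcases Finset.mem_insert.1 hB' with rfl | hB'
      · exact hVD B' _ hg (hgB B' s)
      · exact (hs B' hB').mono_left (hgs B s)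
  obtain ⟨t, ht⟩ := isCompact_univ.elim_finite_subcover V hVo fun x _ => by
    obtain ⟨B, hB, hx⟩ := Set.mem_sUnion.1 (hcov ▸ Set.mem_univ x)
    exact Set.mem_iUnion.2 ⟨⟨B, hB⟩, hBV ⟨B, hB⟩ hx⟩
  obtain ⟨s, hs, -⟩ := finite t
  obtain ⟨x, hx⟩ := hne s
  obtain ⟨B, hB, hxB⟩ := Set.mem_iUnion₂.1 (ht (Set.mem_univ x))
  exact Set.disjoint_left.1 (hs B hB) hx hxB

theorem OmegaStar.compactSpace : CompactSpace OmegaStar := by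
  have h : IsClosed {U : Ultrafilter ℕ | Nonprincipal U} := by
    simp only [Nonprincipal, Set.ofPred_forall]
    exact isClosed_iInter fun A => isClosed_iInter fun _ =>
      (ultrafilter_isOpen_basic A).isClosed_compl
  exact isCompact_iff_compactSpace.1 h.isCompact

theorem OmegaStar.exists_mem_of_infinite {A : Set ℕ} (hA : A.Infinite) :
    ∃ x : OmegaStar, A ∈ x.1 := by
  have : (Filter.cofinite ⊓ Filter.principal A).NeBot := hA.cofinite_inf_principal_neBot
  obtain ⟨U, hU⟩ := Ultrafilter.exists_le (Filter.cofinite ⊓ Filter.principal A)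
  refine ⟨⟨U, fun B hB hBU => ?_⟩, Filter.le_principal_iff.1 (hU.trans inf_le_right)⟩
  exact Ultrafilter.compl_notMem_iff.2 hBU ((hU.trans inf_le_left) hB.compl_mem_cofinite)

theorem OmegaStar.exists_infinite_subset_of_isOpen {U : Set OmegaStar} (hU : IsOpen U)
    (hne : U.Nonempty) : ∃ A : Set ℕ, A.Infinite ∧ {x : OmegaStar | A ∈ x.1} ⊆ U := by
  obtain ⟨x, hx⟩ := hne
  obtain ⟨W, hW, rfl⟩ := isOpen_induced_iff.1 hU
  obtain ⟨_, ⟨A, rfl⟩, hA, hAW⟩ := ultrafilterBasis_is_basis.exists_subset_of_mem_open hx hW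
  exact ⟨A, fun hfin => x.2 A hfin hA, fun y hy => hAW hy⟩

/-- Under CH, `ω*` cannot be covered by nowhere dense P-sets. -/
theorem no_cover_by_nwd_Psets_of_CH
    (ch : (2 : Cardinal) ^ Cardinal.aleph0 = Cardinal.aleph 1) :
    ¬ ∃ 𝒞 : Set (Set OmegaStar),
        (∀ B ∈ 𝒞, IsNowhereDense B ∧ IsPSet B) ∧ ⋃₀ 𝒞 = Set.univ := by
  rintro ⟨C, hC, hcov⟩
  have := OmegaStar.compactSpace
  have : Nonempty OmegaStar := ⟨(OmegaStar.exists_mem_of_infinite Set.infinite_univ).choose⟩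
  have hS : Cardinal.mk {A : Set ℕ // A.Infinite} ≤ Cardinal.aleph 1 := by
    refine (Cardinal.mk_subtype_le _).trans ?_
    rw [Cardinal.mk_set, Cardinal.mk_nat]
    exact Cardinal.lift_le.1 (by simpa using ch.le)
  refine not_sUnion_eq_univ_of_nowhereDense_isPSet hS (fun A => {x : OmegaStar | A.1 ∈ x.1})
    (fun A => (ultrafilter_isClosed_basic A.1).preimage continuous_subtype_val)
    (fun A => (ultrafilter_isOpen_basic A.1).preimage continuous_subtype_val)
    (fun A => OmegaStar.exists_mem_of_infinite A.2) (fun U hU hne => ?_) C hC hcov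
  obtain ⟨A, hA, hAU⟩ := OmegaStar.exists_infinite_subset_of_isOpen hU hne
  exact ⟨⟨A, hA⟩, hAU⟩
end

section
/- Assume CH. Then there exists a nonprincipal ultrafilter U on ℕ that intersects every increasing tower: for every increasing tower {B_α : α < κ}, some B_α belongs to U. -/
open Set

open Ordinal Cardinal in
/-- A set of cardinality `ℵ₁` has an `ω₁`-like ranking: all ranks are countable ordinals, and
only countably many elements lie below any countable ordinal. -/
theorem exists_rank_of_mk_eq_aleph_one {α : Type} (h : #α = ℵ₁) :
    ∃ e : α → Ordinal.{0}, (∀ x, e x < ω₁) ∧ ∀ δ < ω₁, {x | e x < δ}.Countable := by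
  obtain ⟨r, _, hr⟩ := exists_ord_eq α
  rw [h, ord_aleph] at hr
  refine ⟨typein r, fun x => hr ▸ typein_lt_type r x, fun δ hδ => ?_⟩
  have hcard : δ.card ≤ ℵ₀ := by
    rw [lt_omega_iff_card_lt, ← succ_aleph0, Order.lt_succ_iff] at hδ
    exact hδ
  have hδc : (Iio δ).Countable := by
    rw [← le_aleph0_iff_set_countable, Cardinal.mk_Iio_ordinal, lift_le_aleph0]
    exact hcard
  exact hδc.preimage (typein_injective r)

open Ordinal in
/-- Countable ordinals closed under a given function exist above any rank. -/
theorem exists_lt_omega_one_closed {α : Type} (e : α → Ordinal.{0}) (he : ∀ x, e x < ω₁)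
    (hc : ∀ δ < ω₁, {x | e x < δ}.Countable) (a : α) (h : α → α) :
    ∃ δ < ω₁, e a < δ ∧ ∀ x, e x < δ → e (h x) < δ := by
  have hlim : Order.IsSuccLimit ω₁ := Cardinal.isSuccLimit_omega 1
  let F : Ordinal.{0} → Ordinal.{0} := fun δ => ⨆ x : {x // e x < δ}, Order.succ (e (h x))
  let d : ℕ → Ordinal.{0} := fun n => F^[n] (Order.succ (e a))
  have hd : ∀ n, d n < ω₁ := by
    intro n
    induction n with
    | zero => exact hlim.succ_lt (he a)
    | succ n ih =>
      have : Countable {x // e x < d n} := (hc _ ih).to_subtype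
      simp only [d, Function.iterate_succ_apply']
      exact iSup_lt_omega_one fun x => hlim.succ_lt (he _)
  refine ⟨⨆ n, d n, iSup_lt_omega_one hd, ?_, fun x hx => ?_⟩
  · exact (Order.lt_succ (e a)).trans_le (Ordinal.le_iSup d 0)
  · obtain ⟨n, hn⟩ := Ordinal.lt_iSup_iff.1 hx
    refine lt_of_lt_of_le ?_ (Ordinal.le_iSup d (n + 1))
    simp only [d, Function.iterate_succ_apply']
    exact (Order.lt_succ _).trans_le
      (Ordinal.le_iSup (fun x : {x // e x < d n} => Order.succ (e (h x))) ⟨x, hn⟩)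

theorem AlmostSubset.of_subset {A B C : Set ℕ} (h : A ⊆ B) (hBC : AlmostSubset B C) :
    AlmostSubset A C :=
  hBC.subset (sdiff_subset_sdiff_left h)

theorem AlmostSubset.infinite_inter {A B X : Set ℕ} (h : AlmostSubset A B)
    (hX : (A ∩ X).Infinite) : (B ∩ X).Infinite := fun hfin =>
  hX <| (hfin.union h).subset fun x hx => by
    by_cases hB : x ∈ B
    · exact Or.inl ⟨hB, hx.2⟩
    · exact Or.inr ⟨hx.1, hB⟩

/-- In an increasing tower without cofinite members, every sequence of indices is bounded. -/
theorem IsIncTower.exists_upper_bound {κ : Ordinal} {B : Ordinal → Set ℕ} (hB : IsIncTower κ B)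
    (hco : ∀ α < κ, (B α)ᶜ.Infinite) (g : ℕ → Ordinal) (hg : ∀ n, g n < κ) :
    ∃ α < κ, ∀ n, g n < α := by
  by_contra! hcof
  have hpick : ∀ n m : ℕ, ∃ x, m < x ∧ ∀ i ≤ n, x ∉ B (g i) := by
    intro n m
    obtain ⟨j, -, hj⟩ := (Finset.Iic n).exists_max_image g ⟨0, by simp⟩
    have hfin : (⋃ i ∈ Finset.Iic n, B (g i) \ B (g j)).Finite := by
      refine (Finset.Iic n).finite_toSet.biUnion fun i hi => ?_
      rcases (hj i hi).lt_or_eq with hlt | heq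
      · exact hB.2.1 _ _ hlt (hg j)
      · simp [heq]
    obtain ⟨x, ⟨hx, hx'⟩, hmx⟩ := ((hco _ (hg j)).sdiff hfin).exists_gt m
    refine ⟨x, hmx, fun i hi hxi => hx' ?_⟩
    exact mem_biUnion (Finset.mem_Iic.2 hi) ⟨hxi, hx⟩
  choose p hp hpB using hpick
  let s : ℕ → ℕ := Nat.rec (p 0 0) fun n x => p (n + 1) x
  have hs : StrictMono s := strictMono_nat_of_lt_succ fun n => hp _ _
  have hsB : ∀ n, ∀ i ≤ n, s n ∉ B (g i) := by
    rintro (_ | n)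
    · exact hpB 0 0
    · exact hpB (n + 1) (s n)
  obtain ⟨γ, hγ, hinf⟩ := hB.2.2 (range s) (infinite_range_of_injective hs.injective)
  obtain ⟨n, hn⟩ := hcof γ hγ
  have hinf' : (B (g n) ∩ range s).Infinite := by
    rcases hn.lt_or_eq with hlt | heq
    · exact (hB.2.1 _ _ hlt (hg n)).infinite_inter hinf
    · rwa [← heq]
  refine hinf' (((Finset.range n).finite_toSet.image s).subset ?_)
  rintro _ ⟨hx, k, rfl⟩
  refine ⟨k, ?_, rfl⟩
  by_contra hk
  exact hsB k n (by simpa using hk) hx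

/-- `A` captures rank `δ` if each infinite set of rank below `δ` can be shrunk, staying
infinite and of rank below `δ`, to be almost contained in `A`. -/
def Captures (e : Set ℕ → Ordinal.{0}) (A : Set ℕ) (δ : Ordinal.{0}) : Prop :=
  e univ < δ ∧ ∀ X : Set ℕ, X.Infinite → e X < δ →
    ∃ Y ⊆ X, Y.Infinite ∧ e Y < δ ∧ AlmostSubset Y A

theorem captures_of_finite_compl (e : Set ℕ → Ordinal.{0}) {A : Set ℕ} (hA : Aᶜ.Finite) :
    Captures e A (Order.succ (e univ)) :=
  ⟨Order.lt_succ _, fun X hX hXe => ⟨X, Subset.rfl, hX, hXe, hA.subset fun _ hx => hx.2⟩⟩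

theorem exists_infinite_pseudointersection_of_captures (e : Set ℕ → Ordinal.{0})
    (f : Set ℕ → Ordinal.{0}) (s : Finset (Set ℕ)) (hs : ∀ A ∈ s, Captures e A (f A)) :
    ∃ Y : Set ℕ, Y.Infinite ∧ (∀ A ∈ s, AlmostSubset Y A) ∧
      ∀ δ, e univ < δ → (∀ A ∈ s, f A ≤ δ) → e Y < δ := by
  classical
  induction s using Finset.induction_on_max_value f with
  | empty => exact ⟨univ, infinite_univ, by simp, fun δ hδ _ => hδ⟩
  | insert a s _ hmax ih =>
    obtain ⟨Y, hY, hYs, hYe⟩ := ih fun A hA => hs A (Finset.mem_insert_of_mem hA)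
    obtain ⟨ha, hcap⟩ := hs a (Finset.mem_insert_self a s)
    obtain ⟨Z, hZY, hZ, hZe, hZa⟩ := hcap Y hY (hYe _ ha hmax)
    refine ⟨Z, hZ, fun A hA => ?_, fun δ _ hδ =>
      hZe.trans_le (hδ a (Finset.mem_insert_self a s))⟩
    rcases Finset.mem_insert.1 hA with rfl | hA
    · exact hZa
    · exact (hYs A hA).of_subset hZY

theorem generate_captures_neBot (e : Set ℕ → Ordinal.{0}) :
    (Filter.generate {A | ∃ δ, Captures e A δ}).NeBot := by
  refine Filter.generate_neBot_iff.2 fun t ht hfin => ?_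
  choose! f hf using ht
  obtain ⟨Y, hY, hYt, -⟩ := exists_infinite_pseudointersection_of_captures e f hfin.toFinset
    fun A hA => hf (hfin.mem_toFinset.1 hA)
  have hbad : (⋃ A ∈ t, Y \ A).Finite :=
    hfin.biUnion fun A hA => hYt A (hfin.mem_toFinset.2 hA)
  obtain ⟨x, hx, hxt⟩ := (hY.sdiff hbad).nonempty
  refine ⟨x, fun A hA => ?_⟩
  by_contra hxA
  exact hxt (mem_biUnion hA ⟨hx, hxA⟩)

open Ordinal in
theorem IsIncTower.exists_captures {κ : Ordinal} {B : Ordinal → Set ℕ} (hB : IsIncTower κ B)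
    (e : Set ℕ → Ordinal.{0}) (he : ∀ X, e X < ω₁)
    (hc : ∀ δ < ω₁, {X | e X < δ}.Countable) : ∃ α < κ, ∃ δ, Captures e (B α) δ := by
  by_cases hco : ∃ α < κ, (B α)ᶜ.Finite
  · obtain ⟨α, hα, hfin⟩ := hco
    exact ⟨α, hα, _, captures_of_finite_compl e hfin⟩
  push Not at hco
  obtain ⟨γ₀, hγ₀, -⟩ := hB.2.2 univ infinite_univ
  have hmeet : ∀ X : Set ℕ, ∃ γ < κ, X.Infinite → (B γ ∩ X).Infinite := fun X => by
    by_cases hX : X.Infinite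
    · obtain ⟨γ, hγ, h⟩ := hB.2.2 X hX
      exact ⟨γ, hγ, fun _ => h⟩
    · exact ⟨γ₀, hγ₀, fun h => absurd h hX⟩
  choose g hg hgX using hmeet
  obtain ⟨δ, hδ, hδ₀, hδc⟩ := exists_lt_omega_one_closed e he hc univ fun X => B (g X) ∩ X
  obtain ⟨u, hu⟩ := (hc δ hδ).exists_eq_range ⟨univ, hδ₀⟩
  obtain ⟨α, hα, hgα⟩ := hB.exists_upper_bound hco (g ∘ u) fun n => hg _
  refine ⟨α, hα, δ, hδ₀, fun X hX hXδ => ⟨B (g X) ∩ X, inter_subset_right, hgX X hX,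
    hδc X hXδ, ?_⟩⟩
  obtain ⟨n, rfl⟩ : X ∈ range u := hu ▸ hXδ
  exact (hB.2.1 _ _ (hgα n) hα).of_subset inter_subset_left

/-- Under CH, there is a nonprincipal ultrafilter on ℕ that intersects every increasing
tower. -/
theorem exists_ultrafilter_meeting_incTowers_of_CH
    (ch : (2 : Cardinal) ^ Cardinal.aleph0 = Cardinal.aleph 1) :
    ∃ U : Ultrafilter ℕ, Nonprincipal U ∧
      ∀ (κ : Ordinal) (B : Ordinal → Set ℕ), IsIncTower κ B → ∃ α < κ, B α ∈ U := by
  have hcard : Cardinal.mk (Set ℕ) = Cardinal.aleph.{0} 1 := by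
    rw [Cardinal.mk_set, Cardinal.mk_nat]
    exact Cardinal.lift_injective (by simpa using ch)
  obtain ⟨e, he, hc⟩ := exists_rank_of_mk_eq_aleph_one hcard
  have := generate_captures_neBot e
  let U := Ultrafilter.of (Filter.generate {A | ∃ δ, Captures e A δ})
  have hmem : ∀ A δ, Captures e A δ → A ∈ U := fun A δ h =>
    Ultrafilter.of_le _ (Filter.mem_generate_of_mem ⟨δ, h⟩)
  refine ⟨U, fun A hA => ?_, fun κ B hB => ?_⟩
  · exact Ultrafilter.compl_mem_iff_notMem.1
      (hmem _ _ (captures_of_finite_compl e (by rwa [compl_compl])))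
  · obtain ⟨α, hα, δ, h⟩ := hB.exists_captures e he hc
    exact ⟨α, hα, hmem _ _ h⟩
end
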